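/- arXiv:1409.7565 — 2 statements merged into one kernel-verified Lean document; each statement's English description precedes it below -/
import Mathlib

section
/- Let m ∈ ℕ, 0 < p0 ≤ p ≤ 2, and n ∈ ℕ with 2n ≤ m. Then the Weyl numbers of the identity id : ℓ_{p0}^m → ℓ_p^m satisfy x_n(id) ≍ n^{1/p − 1/p0}, with equivalence constants independent of n and m. -/
open scoped ENNReal

instance : Fact ((1 : ℝ≥0∞) ≤ 2) := ⟨one_le_two⟩

/-- The sequence space `ℓ₂` of square-summable complex sequences. -/
noncomputable abbrev ellTwo : Type := lp (fun _ : ℕ => ℂ) 2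

/-- The `ℓ_p` (quasi-)norm on `ℂ^m`, `0 < p < ∞`. -/
noncomputable def lpNorm (p : ℝ) {m : ℕ} (x : Fin m → ℂ) : ℝ≥0∞ :=
  (∑ i, (‖x i‖₊ : ℝ≥0∞) ^ p) ^ (1 / p)

/-- The `n`-th Weyl number of the identity between two quasi-normed structures
`N₁, N₂` on a complex vector space `W`:
`x_n(id) = sup_{A : ℓ₂ → (W,N₁), ‖A‖ ≤ 1} a_n(id ∘ A)`, where
`a_n(T) = inf_{rank F < n} sup_{‖u‖_{ℓ₂} ≤ 1} N₂((T - F)u)`. -/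
noncomputable def genWeylNum (W : Type*) [AddCommGroup W] [Module ℂ W]
    (N₁ N₂ : W → ℝ≥0∞) (n : ℕ) : ℝ≥0∞ :=
  ⨆ A : {A : ellTwo →ₗ[ℂ] W // ∀ u, N₁ (A u) ≤ ENNReal.ofReal ‖u‖},
    ⨅ F : {F : ellTwo →ₗ[ℂ] W // Module.rank ℂ (LinearMap.range F) < (n : Cardinal)},
      ⨆ u : {u : ellTwo // ‖u‖ ≤ 1}, N₂ (A.1 u.1 - F.1 u.1)

theorem exists_mem_submodule_card_le_norm_eq_one {ι : Type*} [Fintype ι] (E : Submodule ℂ (ι → ℂ)) :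
    ∃ x ∈ E, (∀ i, ‖x i‖ ≤ 1) ∧
      Module.finrank ℂ E ≤ (Finset.univ.filter fun i => ‖x i‖ = 1).card := by
  classical
  have hK : IsCompact ((E : Set (ι → ℂ)) ∩ Metric.closedBall 0 1) :=
    (isCompact_closedBall _ _).inter_left E.closed_of_finiteDimensional
  obtain ⟨x, ⟨hxE, hx1⟩, hmax⟩ := hK.exists_isMaxOn ⟨0, E.zero_mem, by simp⟩
    (f := fun x : ι → ℂ => ∑ i, ‖x i‖ ^ 2) (by fun_prop)
  rw [mem_closedBall_zero_iff, pi_norm_le_iff_of_nonneg zero_le_one] at hx1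
  refine ⟨x, hxE, hx1, ?_⟩
  by_contra! hlt
  set J := Finset.univ.filter fun i => ‖x i‖ = 1
  let R : E →ₗ[ℂ] (J → ℂ) := (LinearMap.funLeft ℂ ℂ (Subtype.val : J → ι)).comp E.subtype
  have hker : LinearMap.ker R ≠ ⊥ := LinearMap.ker_ne_bot_of_finrank_lt (by simpa using hlt)
  obtain ⟨⟨v, hvE⟩, hvR, hv0⟩ := (Submodule.ne_bot_iff _).1 hker
  have hvJ : ∀ i, ‖x i‖ = 1 → v i = 0 := fun i hi =>
    congrFun (LinearMap.mem_ker.1 hvR) ⟨i, by simp [J, hi]⟩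
  have hε : ∀ᶠ ε : ℝ in nhdsWithin 0 (Set.Ioi 0), ∀ i, ‖x i‖ + ε * ‖v i‖ ≤ 1 := by
    rw [Filter.eventually_all]
    intro i
    rcases (hx1 i).eq_or_lt with hi | hi
    · simp [hvJ i hi, hi]
    · have : Filter.Tendsto (fun ε : ℝ => ‖x i‖ + ε * ‖v i‖) (nhdsWithin 0 (Set.Ioi 0))
          (nhds (‖x i‖ + 0 * ‖v i‖)) :=
        ((by fun_prop : Continuous fun ε : ℝ => ‖x i‖ + ε * ‖v i‖).tendsto 0).mono_left
          nhdsWithin_le_nhds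
      filter_upwards [this.eventually_lt_const (u := 1) (by simpa using hi)] with ε h
      exact h.le
  obtain ⟨ε, hε1, hε0⟩ := (hε.and self_mem_nhdsWithin).exists
  replace hε0 : 0 < ε := hε0
  have hmem : ∀ c : ℂ, ‖c‖ = ε → ∑ i, ‖(x + c • v) i‖ ^ 2 ≤ ∑ i, ‖x i‖ ^ 2 := by
    intro c hc
    refine hmax ⟨E.add_mem hxE (E.smul_mem _ hvE), ?_⟩
    rw [mem_closedBall_zero_iff, pi_norm_le_iff_of_nonneg zero_le_one]
    intro i
    refine (norm_add_le _ _).trans ?_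
    simpa [hc] using hε1 i
  have h1 := hmem ε (by simp [hε0.le])
  have h2 := hmem (-ε) (by simp [hε0.le])
  have hpar : ∑ i, ‖(x + (ε : ℂ) • v) i‖ ^ 2 + ∑ i, ‖(x + (-ε : ℂ) • v) i‖ ^ 2
      = 2 * ∑ i, ‖x i‖ ^ 2 + 2 * ε ^ 2 * ∑ i, ‖v i‖ ^ 2 := by
    simp only [Finset.mul_sum, ← Finset.sum_add_distrib]
    refine Finset.sum_congr rfl fun i _ => ?_
    have := parallelogram_law_with_norm ℝ (x i) (ε * v i)
    rw [norm_mul, Complex.norm_real, Real.norm_of_nonneg hε0.le] at this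
    simp only [Pi.add_apply, Pi.smul_apply, smul_eq_mul, neg_mul, ← sub_eq_add_neg]
    nlinarith
  have hpos : 0 < ∑ i, ‖v i‖ ^ 2 := by
    obtain ⟨i, hi⟩ := Function.ne_iff.1 (fun h => hv0 (Subtype.ext h) : v ≠ 0)
    exact Finset.sum_pos' (fun _ _ => by positivity)
      ⟨i, Finset.mem_univ i, by have := norm_pos_iff.2 hi; positivity⟩
  have : 0 < ε ^ 2 * ∑ i, ‖v i‖ ^ 2 := by positivity
  linarith

theorem exists_mem_submodule_l2_le_lq {ι : Type*} [Fintype ι] (E : Submodule ℂ (ι → ℂ)) {n : ℕ}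
    (hn : 1 ≤ n) (hE : n ≤ Module.finrank ℂ E) {q : ℝ} (hq0 : 0 < q) (hq2 : q ≤ 2) :
    ∃ x ∈ E, x ≠ 0 ∧ √(∑ i, ‖x i‖ ^ 2) ≤
      (n : ℝ) ^ (1 / 2 - 1 / q) * (∑ i, ‖x i‖ ^ q) ^ (1 / q) := by
  obtain ⟨x, hxE, hx1, hcard⟩ := exists_mem_submodule_card_le_norm_eq_one E
  have hns : (n : ℝ) ≤ ∑ i, ‖x i‖ ^ 2 := by
    calc (n : ℝ) ≤ ((Finset.univ.filter fun i => ‖x i‖ = 1).card : ℝ) := by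
          exact_mod_cast hE.trans hcard
      _ = ∑ i with ‖x i‖ = 1, ‖x i‖ ^ 2 := by
          rw [Finset.card_eq_sum_ones, Nat.cast_sum]
          refine Finset.sum_congr rfl fun i hi => ?_
          simp [(Finset.mem_filter.1 hi).2]
      _ ≤ _ := Finset.sum_le_sum_of_subset_of_nonneg (Finset.filter_subset _ _)
          fun _ _ _ => by positivity
  have hn1 : (1 : ℝ) ≤ n := by exact_mod_cast hn
  set s := ∑ i, ‖x i‖ ^ 2 with hs
  have hs0 : 0 < s := by linarith
  have hsq : s ≤ ∑ i, ‖x i‖ ^ q := by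
    refine Finset.sum_le_sum fun i _ => ?_
    rw [← Real.rpow_natCast]
    exact Real.rpow_le_rpow_of_exponent_ge' (norm_nonneg _) (hx1 i) hq0.le (by simpa using hq2)
  refine ⟨x, hxE, ?_, ?_⟩
  · rintro rfl
    simp [hs] at hs0
  · have he : (1 : ℝ) / 2 - 1 / q ≤ 0 := by
      have := one_div_le_one_div_of_le hq0 hq2
      linarith
    calc √s = s ^ (1 / 2 - 1 / q) * s ^ (1 / q) := by
          rw [← Real.rpow_add hs0, Real.sqrt_eq_rpow]; congr 1; ring
      _ ≤ _ := mul_le_mul (Real.rpow_le_rpow_of_nonpos (by linarith) hns he)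
          (Real.rpow_le_rpow hs0.le hsq (by positivity)) (by positivity) (by positivity)

open ContinuousLinearMap in
theorem exists_finiteDimensional_norm_le_on_orthogonal {H G : Type*} [NormedAddCommGroup H]
    [InnerProductSpace ℂ H] [CompleteSpace H] [NormedAddCommGroup G] [InnerProductSpace ℂ G]
    [FiniteDimensional ℂ G] (A : H →L[ℂ] G) {σ : ℝ} (hσ : 0 < σ) :
    ∃ (K : Submodule ℂ H) (W : Submodule ℂ G), FiniteDimensional ℂ K ∧
      Module.finrank ℂ K ≤ Module.finrank ℂ W ∧ (∀ u ∈ Kᗮ, ‖A u‖ ≤ σ * ‖u‖) ∧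
      ∀ w ∈ W, w ≠ 0 → ∃ v, A v = w ∧ σ * ‖v‖ < ‖w‖ := by
  classical
  have : CompleteSpace G := FiniteDimensional.complete ℂ G
  let T : G →ₗ[ℂ] G := (A ∘L adjoint A : G →L[ℂ] G)
  have hTdef : ∀ y, T y = A (adjoint A y) := fun _ => rfl
  have hT : T.IsSymmetric := fun x y =>
    (adjoint_inner_right A (adjoint A x) y).symm.trans (adjoint_inner_left A (adjoint A y) x)
  let b := hT.eigenvectorBasis rfl
  let lam := hT.eigenvalues rfl
  have hb : ∀ i, T (b i) = (lam i : ℂ) • b i := hT.apply_eigenvectorBasis rfl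
  have hA : ∀ y, ‖adjoint A y‖ ^ 2 = ∑ i, lam i * ‖inner ℂ (b i) y‖ ^ 2 := by
    intro y
    have h1 : (‖adjoint A y‖ ^ 2 : ℂ) = inner ℂ y (T y) := by
      rw [hTdef, ← adjoint_inner_left, inner_self_eq_norm_sq_to_K]; rfl
    have h2 : inner ℂ y (T y) = ((∑ i, lam i * ‖inner ℂ (b i) y‖ ^ 2 : ℝ) : ℂ) := by
      rw [← b.sum_inner_mul_inner, Complex.ofReal_sum]
      refine Finset.sum_congr rfl fun i _ => ?_
      rw [← hT, hb, inner_smul_left, ← inner_conj_symm y, Complex.conj_ofReal]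
      have := RCLike.conj_mul (inner ℂ (b i) y)
      push_cast
      linear_combination (lam i : ℂ) * this
    rw [h2] at h1
    exact_mod_cast h1
  let I : Set (Fin (Module.finrank ℂ G)) := {i | σ ^ 2 < lam i}
  let W : Submodule ℂ G := Submodule.span ℂ (Set.image b I)
  refine ⟨W.map (adjoint A : G →ₗ[ℂ] H), W, inferInstance, Submodule.finrank_map_le _ _, ?_, ?_⟩
  · intro u hu
    have h0 : ∀ i ∈ I, inner ℂ (b i) (A u) = 0 := fun i hi => by
      rw [← adjoint_inner_left]
      exact hu _ (Submodule.mem_map_of_mem (Submodule.subset_span ⟨i, hi, rfl⟩))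
    have h1 : ‖adjoint A (A u)‖ ^ 2 ≤ (σ * ‖A u‖) ^ 2 := by
      rw [hA, mul_pow, ← b.sum_sq_norm_inner_right (A u), Finset.mul_sum]
      refine Finset.sum_le_sum fun i _ => ?_
      by_cases hi : i ∈ I
      · simp [h0 i hi]
      · exact mul_le_mul_of_nonneg_right (not_lt.1 hi) (by positivity)
    have h2 := (pow_le_pow_iff_left₀ (norm_nonneg _) (by positivity) two_ne_zero).1 h1
    have h3 : ‖A u‖ ^ 2 ≤ ‖adjoint A (A u)‖ * ‖u‖ := by
      have : ‖A u‖ ^ 2 = ‖inner ℂ (A u) (A u)‖ := by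
        rw [inner_self_eq_norm_sq_to_K]; simp
      rw [this, ← adjoint_inner_left]
      exact norm_inner_le_norm _ _
    rcases (norm_nonneg (A u)).eq_or_lt with h | h
    · rw [← h]; positivity
    · have h4 : ‖adjoint A (A u)‖ * ‖u‖ ≤ σ * ‖A u‖ * ‖u‖ :=
        mul_le_mul_of_nonneg_right h2 (norm_nonneg _)
      nlinarith
  · intro w hw hw0
    have hc : ∀ i ∉ I, inner ℂ (b i) w = 0 := by
      intro i hi
      refine Submodule.span_induction (p := fun w _ => inner ℂ (b i) w = 0) ?_ (by simp) ?_ ?_ hw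
      · rintro _ ⟨j, hj, rfl⟩
        exact b.orthonormal.2 (fun h => hi (h ▸ hj))
      · intro x y _ _ hx hy; simp [hx, hy]
      · intro a x _ hx; simp [hx]
    let z : G := ∑ i, (inner ℂ (b i) w / (lam i : ℂ)) • b i
    have hz : ∀ i, inner ℂ (b i) z = inner ℂ (b i) w / (lam i : ℂ) := fun i =>
      b.orthonormal.inner_right_fintype _ i
    have hlam : ∀ i ∈ I, 0 < lam i := fun i hi => (by positivity : 0 < σ ^ 2).trans hi
    refine ⟨adjoint A z, ?_, ?_⟩
    · rw [← hTdef, map_sum, ← b.sum_repr' w]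
      refine Finset.sum_congr rfl fun i _ => ?_
      rw [map_smul, hb, smul_smul, b.sum_repr' w]
      by_cases hi : i ∈ I
      · have : (lam i : ℂ) ≠ 0 := by exact_mod_cast (hlam i hi).ne'
        rw [div_mul_cancel₀ _ this]
      · simp [hc i hi]
    · refine lt_of_pow_lt_pow_left₀ 2 (norm_nonneg _) ?_
      rw [mul_pow, hA, ← b.sum_sq_norm_inner_right w, Finset.mul_sum]
      have key : ∀ i ∈ I, σ ^ 2 * (lam i * ‖inner ℂ (b i) z‖ ^ 2) =
          σ ^ 2 / lam i * ‖inner ℂ (b i) w‖ ^ 2 := fun i hi => by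
        have h := hlam i hi
        rw [hz, norm_div, Complex.norm_real, Real.norm_of_nonneg h.le]
        field_simp
      have hle : ∀ i ∈ I, σ ^ 2 / lam i < 1 := fun i hi => by
        rw [div_lt_one (hlam i hi)]; exact hi
      have hex : ∃ i, inner ℂ (b i) w ≠ 0 := by
        by_contra! h
        apply hw0
        rw [← b.sum_repr' w]
        simp [h]
      refine Finset.sum_lt_sum (fun i _ => ?_) ?_
      · by_cases hi : i ∈ I
        · rw [key i hi]
          exact mul_le_of_le_one_left (by positivity) (hle i hi).le
        · simp [hz, hc i hi]
      · obtain ⟨i, hi0⟩ := hex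
        have hi : i ∈ I := by by_contra h; exact hi0 (hc i h)
        refine ⟨i, Finset.mem_univ i, ?_⟩
        rw [key i hi]
        have := norm_pos_iff.2 hi0
        exact mul_lt_of_lt_one_left (by positivity) (hle i hi)

theorem lpNorm_eq_ofReal {q : ℝ} (hq : 0 < q) {m : ℕ} (x : Fin m → ℂ) :
    lpNorm q x = ENNReal.ofReal ((∑ i, ‖x i‖ ^ q) ^ (1 / q)) := by
  rw [lpNorm, ← ENNReal.ofReal_rpow_of_nonneg (by positivity) (by positivity),
    ENNReal.ofReal_sum_of_nonneg fun _ _ => by positivity]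
  congr 1
  refine Finset.sum_congr rfl fun i _ => ?_
  rw [← ENNReal.ofReal_rpow_of_nonneg (norm_nonneg _) hq.le, ofReal_norm]
  rfl

theorem sum_norm_smul_rpow {ι : Type*} [Fintype ι] {q : ℝ} (hq : 0 < q) (c : ℂ) (x : ι → ℂ) :
    (∑ i, ‖(c • x) i‖ ^ q) ^ (1 / q) = ‖c‖ * (∑ i, ‖x i‖ ^ q) ^ (1 / q) := by
  simp only [Pi.smul_apply, norm_smul]
  rw [Finset.sum_congr rfl fun i _ => Real.mul_rpow (norm_nonneg c) (norm_nonneg (x i)),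
    ← Finset.mul_sum, Real.mul_rpow (by positivity) (by positivity), ← Real.rpow_mul (norm_nonneg _),
    mul_one_div_cancel hq.ne', Real.rpow_one]

theorem sum_norm_rpow_le_interpolation {ι : Type*} [Fintype ι] {p₀ p σ : ℝ} (hp₀ : 0 < p₀)
    (hp₀p : p₀ ≤ p) (hp2 : p ≤ 2) (h02 : p₀ < 2) (hσ : 0 < σ) (x : ι → ℂ)
    (h0 : ∑ i, ‖x i‖ ^ p₀ ≤ 1) (h2 : ∑ i, ‖x i‖ ^ 2 ≤ σ ^ 2) :
    ∑ i, ‖x i‖ ^ p ≤ (σ ^ 2) ^ ((p - p₀) / (2 - p₀)) := by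
  set t := (p - p₀) / (2 - p₀) with ht
  have hd : 0 < 2 - p₀ := by linarith
  have ht0 : 0 ≤ t := div_nonneg (by linarith) hd.le
  have ht1 : t ≤ 1 := (div_le_one hd).2 (by linarith)
  have hpt : p = p₀ * (1 - t) + 2 * t := by
    rw [ht]; field_simp; ring
  have hpoint : ∀ i, ‖x i‖ ^ p ≤
      (σ ^ 2) ^ t * ((1 - t) * ‖x i‖ ^ p₀ + t * (‖x i‖ ^ 2 / σ ^ 2)) := by
    intro i
    calc ‖x i‖ ^ p = (σ ^ 2) ^ t * ((‖x i‖ ^ p₀) ^ (1 - t) * (‖x i‖ ^ 2 / σ ^ 2) ^ t) := by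
          rw [Real.div_rpow (by positivity) (by positivity), ← Real.rpow_natCast ‖x i‖ 2,
            ← Real.rpow_mul (norm_nonneg _), ← Real.rpow_mul (norm_nonneg _)]
          have : (σ ^ 2) ^ t ≠ 0 := by positivity
          field_simp
          rw [← Real.rpow_add_of_nonneg (norm_nonneg _) (by nlinarith)
            (by push_cast; linarith)]
          congr 1
          push_cast
          linarith
      _ ≤ _ := mul_le_mul_of_nonneg_left (Real.geom_mean_le_arith_mean2_weighted (by linarith) ht0
          (by positivity) (by positivity) (by ring)) (by positivity)
  calc ∑ i, ‖x i‖ ^ p ≤ ∑ i, (σ ^ 2) ^ t * ((1 - t) * ‖x i‖ ^ p₀ + t * (‖x i‖ ^ 2 / σ ^ 2)) :=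
        Finset.sum_le_sum fun i _ => hpoint i
    _ = (σ ^ 2) ^ t * ((1 - t) * ∑ i, ‖x i‖ ^ p₀ + t * ((∑ i, ‖x i‖ ^ 2) / σ ^ 2)) := by
        rw [← Finset.mul_sum, Finset.sum_add_distrib, ← Finset.mul_sum, ← Finset.mul_sum,
          Finset.sum_div]
    _ ≤ (σ ^ 2) ^ t * ((1 - t) * 1 + t * 1) := by
        have : (∑ i, ‖x i‖ ^ 2) / σ ^ 2 ≤ 1 := (div_le_one (by positivity)).2 h2
        have h1t : 0 ≤ 1 - t := by linarith
        gcongr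
    _ = _ := by ring

theorem sum_rpow_le_card_rpow_mul_sqrt {N : ℕ} {q : ℝ} (hq : 0 < q) (hq2 : q ≤ 2)
    (y : Fin N → ℂ) :
    (∑ i, ‖y i‖ ^ q) ^ (1 / q) ≤ (N : ℝ) ^ (1 / q - 1 / 2) * √(∑ i, ‖y i‖ ^ 2) := by
  have h := Real.rpow_sum_le_const_mul_sum_rpow_of_nonneg (Finset.univ : Finset (Fin N))
    (f := fun i => ‖y i‖ ^ q) (p := 2 / q) ((one_le_div hq).2 hq2) (fun i _ => by positivity)
  have h' : ∀ i, (‖y i‖ ^ q) ^ (2 / q) = ‖y i‖ ^ 2 := fun i => by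
    rw [← Real.rpow_mul (norm_nonneg _), mul_div_cancel₀ _ hq.ne', Real.rpow_two]
  simp only [h', Finset.card_univ, Fintype.card_fin] at h
  have h3 := Real.rpow_le_rpow (by positivity) h (z := 1 / 2) (by norm_num)
  rw [← Real.rpow_mul (by positivity), Real.mul_rpow (by positivity) (by positivity),
    ← Real.rpow_mul (by positivity), ← Real.sqrt_eq_rpow] at h3
  convert h3 using 2 <;> ring_nf

theorem exists_rank_lt_lpNorm_sub_le {p₀ p : ℝ} (hp₀ : 0 < p₀) (hp₀p : p₀ ≤ p) (hp2 : p ≤ 2)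
    {m n : ℕ} (hn : 1 ≤ n) (A : ellTwo →ₗ[ℂ] (Fin m → ℂ))
    (hA : ∀ u, lpNorm p₀ (A u) ≤ ENNReal.ofReal ‖u‖) :
    ∃ F : ellTwo →ₗ[ℂ] (Fin m → ℂ), Module.rank ℂ (LinearMap.range F) < (n : Cardinal) ∧
      ∀ u, ‖u‖ ≤ 1 → lpNorm p (A u - F u) ≤ ENNReal.ofReal ((n : ℝ) ^ (1 / p - 1 / p₀)) := by
  have hp : 0 < p := hp₀.trans_le hp₀p
  have hn0 : (0 : ℝ) < n := by exact_mod_cast hn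
  have hAr : ∀ u, (∑ i, ‖A u i‖ ^ p₀) ^ (1 / p₀) ≤ ‖u‖ := fun u => by
    have := hA u
    rwa [lpNorm_eq_ofReal hp₀, ENNReal.ofReal_le_ofReal_iff (norm_nonneg _)] at this
  have hcoord : ∀ u i, ‖A u i‖ ≤ ‖u‖ := fun u i => by
    refine le_trans ?_ (hAr u)
    calc ‖A u i‖ = (‖A u i‖ ^ p₀) ^ (1 / p₀) := by
          rw [← Real.rpow_mul (norm_nonneg _), mul_one_div_cancel hp₀.ne', Real.rpow_one]
      _ ≤ _ := Real.rpow_le_rpow (by positivity)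
          (Finset.single_le_sum (f := fun i => ‖A u i‖ ^ p₀) (fun _ _ => by positivity)
            (Finset.mem_univ i)) (by positivity)
  let e := WithLp.linearEquiv 2 ℂ (Fin m → ℂ)
  let B : ellTwo →L[ℂ] EuclideanSpace ℂ (Fin m) :=
    (e.symm.toLinearMap ∘ₗ A).mkContinuous (√m) fun u => by
      rw [EuclideanSpace.norm_eq]
      refine (Real.sqrt_le_sqrt (Finset.sum_le_sum (g := fun _ => ‖u‖ ^ 2) fun i _ => ?_)).trans ?_
      · exact pow_le_pow_left₀ (norm_nonneg _) (hcoord u i) 2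
      · simp
  have hB : ∀ u, ‖B u‖ = √(∑ i, ‖A u i‖ ^ 2) := fun u => EuclideanSpace.norm_eq _
  have heB : ∀ u, e (B u) = A u := fun u => e.apply_symm_apply _
  set σ : ℝ := (n : ℝ) ^ (1 / 2 - 1 / p₀) with hσdef
  have hσ : 0 < σ := by positivity
  obtain ⟨K, W, hKfin, hKW, hKorth, hWlarge⟩ := exists_finiteDimensional_norm_le_on_orthogonal B hσ
  have hWn : Module.finrank ℂ W < n := by
    by_contra! h
    obtain ⟨x, hx, hx0, hxle⟩ := exists_mem_submodule_l2_le_lq (W.map e.toLinearMap) hn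
      (by rw [LinearEquiv.finrank_map_eq]; exact h) hp₀ (hp₀p.trans hp2)
    obtain ⟨w, hw, rfl⟩ := hx
    obtain ⟨v, hv, hvlt⟩ := hWlarge w hw (by rintro rfl; exact hx0 (map_zero _))
    have hAv : A v = e w := by rw [← heB, hv]
    rw [← hv, hB, hAv] at hvlt
    refine absurd (hvlt.trans_le hxle) (not_lt.2 (mul_le_mul_of_nonneg_left ?_ hσ.le))
    rw [LinearEquiv.coe_coe, ← hAv]
    exact hAr v
  let P : ellTwo →ₗ[ℂ] ellTwo := K.starProjection
  refine ⟨A ∘ₗ P, ?_, fun u hu => ?_⟩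
  · refine (LinearMap.rank_comp_le_right P A).trans_lt ?_
    have hr : LinearMap.range P = K := Submodule.range_starProjection K
    rw [LinearMap.rank, hr, ← Module.finrank_eq_rank]
    exact_mod_cast hKW.trans_lt hWn
  · set v := u - K.starProjection u with hv
    have hvK : v ∈ Kᗮ := Submodule.sub_starProjection_mem_orthogonal u
    have hv1 : ‖v‖ ≤ 1 := by
      have h1 := Submodule.norm_sq_eq_add_norm_sq_starProjection u K
      rw [Submodule.starProjection_orthogonal_val, ← hv] at h1
      nlinarith [norm_nonneg u, norm_nonneg v, sq_nonneg ‖K.starProjection u‖]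
    have hsub : A u - (A ∘ₗ P) u = A v := by simp [hv, P]
    rw [hsub, lpNorm_eq_ofReal hp]
    refine ENNReal.ofReal_le_ofReal ?_
    have h0 : ∑ i, ‖A v i‖ ^ p₀ ≤ 1 := by
      have := Real.rpow_le_rpow (by positivity) ((hAr v).trans hv1) hp₀.le
      rwa [← Real.rpow_mul (by positivity), one_div_mul_cancel hp₀.ne', Real.rpow_one,
        Real.one_rpow] at this
    rcases hp₀p.eq_or_lt with rfl | hlt
    · simpa using (hAr v).trans hv1
    · have h02 : p₀ < 2 := hlt.trans_le hp2
      have h2 : ∑ i, ‖A v i‖ ^ 2 ≤ σ ^ 2 := by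
        rw [← Real.sqrt_le_left hσ.le, ← hB]
        exact (hKorth v hvK).trans (mul_le_of_le_one_right hσ.le hv1)
      have h := Real.rpow_le_rpow (by positivity)
        (sum_norm_rpow_le_interpolation hp₀ hp₀p hp2 h02 hσ (A v) h0 h2)
        (by positivity : 0 ≤ 1 / p)
      refine h.trans_eq ?_
      rw [hσdef, ← Real.rpow_natCast, ← Real.rpow_mul hn0.le, ← Real.rpow_mul hn0.le,
        ← Real.rpow_mul hn0.le]
      congr 1
      have : 2 - p₀ ≠ 0 := by linarith
      push_cast
      field_simp
      ring

/-- The restriction of a sequence in `ℓ₂` to its first `N` coordinates. -/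
noncomputable def ellTwoRestrict (N : ℕ) : ellTwo →ₗ[ℂ] (Fin N → ℂ) where
  toFun u j := u j
  map_add' _ _ := rfl
  map_smul' _ _ := rfl

theorem sum_norm_sq_ellTwoRestrict_le (N : ℕ) (u : ellTwo) :
    ∑ j, ‖ellTwoRestrict N u j‖ ^ 2 ≤ ‖u‖ ^ 2 := by
  have h := lp.sum_rpow_le_norm_rpow (p := 2) (by simp) u (Finset.range N)
  simp only [ENNReal.toReal_ofNat, Real.rpow_two] at h
  rwa [← Fin.sum_univ_eq_sum_range (fun k => ‖u k‖ ^ 2)] at h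

theorem exists_ellTwoRestrict_rightInverse (N : ℕ) :
    ∃ ι : (Fin N → ℂ) →ₗ[ℂ] ellTwo, (∀ x, ellTwoRestrict N (ι x) = x) ∧
      ∀ x, ‖ι x‖ ^ 2 = ∑ j, ‖x j‖ ^ 2 := by
  let E := Function.ExtendByZero.linearMap ℂ (Fin.val : Fin N → ℕ)
  have hE : ∀ x j, E x (Fin.val j) = x j := fun x j => Fin.val_injective.extend_apply _ _ _
  have hE0 : ∀ x k, k ∉ Set.range (Fin.val : Fin N → ℕ) → E x k = 0 := fun x k hk =>
    Function.extend_apply' _ _ _ hk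
  have hsum : ∀ x, HasSum (fun k => ‖E x k‖ ^ 2) (∑ j, ‖x j‖ ^ 2) := fun x => by
    rw [← Fin.val_injective.hasSum_iff fun k hk => by simp [hE0 x k hk]]
    have h : (fun k => ‖E x k‖ ^ 2) ∘ Fin.val = fun j => ‖x j‖ ^ 2 :=
      funext fun j => by rw [Function.comp_apply, hE x j]
    rw [h]
    exact hasSum_fintype _
  have hmem : ∀ x, Memℓp (E x) 2 := fun x =>
    memℓp_gen (by simpa using (hsum x).summable)
  refine ⟨{ toFun := fun x => ⟨E x, hmem x⟩
            map_add' := fun x y => Subtype.ext (map_add E x y)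
            map_smul' := fun c x => Subtype.ext (map_smul E c x) }, fun x => ?_, fun x => ?_⟩
  · exact funext fun j => hE x j
  · have h := lp.norm_rpow_eq_tsum (p := 2) (by simp) (⟨E x, hmem x⟩ : ellTwo)
    simp only [ENNReal.toReal_ofNat, Real.rpow_two] at h
    exact h.trans (hsum x).tsum_eq

theorem exists_forall_rank_lt_le_lpNorm_sub {p₀ p : ℝ} (hp₀ : 0 < p₀) (hp₀p : p₀ ≤ p)
    (hp2 : p ≤ 2) {m n : ℕ} (hn : 1 ≤ n) (hnm : 2 * n ≤ m) :
    ∃ A : ellTwo →ₗ[ℂ] (Fin m → ℂ), (∀ u, lpNorm p₀ (A u) ≤ ENNReal.ofReal ‖u‖) ∧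
      ∀ F : ellTwo →ₗ[ℂ] (Fin m → ℂ), Module.rank ℂ (LinearMap.range F) < (n : Cardinal) →
        ∃ u, ‖u‖ ≤ 1 ∧
          ENNReal.ofReal ((2 : ℝ) ^ (1 / 2 - 1 / p₀) * (n : ℝ) ^ (1 / p - 1 / p₀)) ≤
            lpNorm p (A u - F u) := by
  have hp : 0 < p := hp₀.trans_le hp₀p
  have hn0 : (0 : ℝ) < n := by exact_mod_cast hn
  have hN0 : (0 : ℝ) < (2 * n : ℕ) := by push_cast; positivity
  set c : ℝ := ((2 * n : ℕ) : ℝ) ^ (1 / 2 - 1 / p₀) with hc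
  have hc0 : 0 < c := by positivity
  have hnc : ‖(c : ℂ)‖ = c := by simp [hc0.le]
  let X := Function.ExtendByZero.linearMap ℂ (Fin.castLE hnm)
  have hX : ∀ {q : ℝ}, 0 < q → ∀ y, ∑ i, ‖X y i‖ ^ q = ∑ j, ‖y j‖ ^ q := fun {q} hq y => by
    refine (Fintype.sum_of_injective (Fin.castLE hnm) (Fin.castLE_injective hnm) _ _
      (fun i hi => ?_) fun j => ?_).symm
    · have : X y i = 0 := Function.extend_apply' _ _ _ hi
      rw [this, norm_zero, Real.zero_rpow hq.ne']
    · have : X y (Fin.castLE hnm j) = y j := (Fin.castLE_injective hnm).extend_apply _ _ _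
      rw [this]
  have hXN : ∀ {q : ℝ}, 0 < q → ∀ y, lpNorm q (((c : ℂ) • X) y) =
      ENNReal.ofReal (c * (∑ j, ‖y j‖ ^ q) ^ (1 / q)) := fun {q} hq y => by
    rw [lpNorm_eq_ofReal hq, LinearMap.smul_apply, sum_norm_smul_rpow hq, hX hq, hnc]
  refine ⟨((c : ℂ) • X) ∘ₗ ellTwoRestrict (2 * n), fun u => ?_, fun F hF => ?_⟩
  · rw [LinearMap.comp_apply, hXN hp₀]
    refine ENNReal.ofReal_le_ofReal ?_
    calc _ ≤ c * (((2 * n : ℕ) : ℝ) ^ (1 / p₀ - 1 / 2) * ‖u‖) := by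
          refine mul_le_mul_of_nonneg_left
            ((sum_rpow_le_card_rpow_mul_sqrt hp₀ (hp₀p.trans hp2) _).trans ?_) hc0.le
          refine mul_le_mul_of_nonneg_left ?_ (by positivity)
          exact (Real.sqrt_le_left (norm_nonneg _)).2 (sum_norm_sq_ellTwoRestrict_le _ u)
      _ = ‖u‖ := by
          rw [hc, ← mul_assoc, ← Real.rpow_add hN0]
          simp
  · obtain ⟨ι, hι, hιnorm⟩ := exists_ellTwoRestrict_rightInverse (2 * n)
    have hker : n ≤ Module.finrank ℂ (LinearMap.ker (F ∘ₗ ι)) := by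
      have h1 := LinearMap.finrank_range_add_finrank_ker (F ∘ₗ ι)
      have h2 : Module.rank ℂ (LinearMap.range (F ∘ₗ ι)) < (n : Cardinal) :=
        (LinearMap.rank_comp_le_left ι F).trans_lt hF
      rw [← Module.finrank_eq_rank, Nat.cast_lt] at h2
      rw [Module.finrank_fin_fun] at h1
      omega
    obtain ⟨x, hx, hx0, hxle⟩ := exists_mem_submodule_l2_le_lq _ hn hker hp hp2
    set s := √(∑ i, ‖x i‖ ^ 2) with hs
    have hιx : ‖ι x‖ = s := by rw [hs, ← hιnorm, Real.sqrt_sq (norm_nonneg _)]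
    have hs0 : 0 < s := by
      rw [← hιx, norm_pos_iff]
      intro h
      apply hx0
      rw [← hι x, h, map_zero]
    refine ⟨ι ((s⁻¹ : ℂ) • x), ?_, ?_⟩
    · rw [map_smul, norm_smul, hιx]
      simp [abs_of_pos hs0, hs0.ne']
    · have hF0 : F (ι ((s⁻¹ : ℂ) • x)) = 0 := by
        have : F (ι x) = 0 := hx
        rw [map_smul, map_smul, this, smul_zero]
      rw [hF0, sub_zero, LinearMap.comp_apply, hι, hXN hp, sum_norm_smul_rpow hp]
      refine ENNReal.ofReal_le_ofReal ?_
      have hns : ‖(s⁻¹ : ℂ)‖ = s⁻¹ := by simp [hs0.le]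
      have h3 : (n : ℝ) ^ (1 / p - 1 / 2) ≤ s⁻¹ * (∑ i, ‖x i‖ ^ p) ^ (1 / p) := by
        rw [inv_mul_eq_div, le_div_iff₀ hs0]
        calc _ ≤ (n : ℝ) ^ (1 / p - 1 / 2) *
              ((n : ℝ) ^ (1 / 2 - 1 / p) * (∑ i, ‖x i‖ ^ p) ^ (1 / p)) :=
              mul_le_mul_of_nonneg_left hxle (by positivity)
          _ = _ := by rw [← mul_assoc, ← Real.rpow_add hn0]; simp
      rw [hns]
      refine le_trans (le_of_eq ?_) (mul_le_mul_of_nonneg_left h3 hc0.le)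
      rw [hc]
      push_cast
      rw [Real.mul_rpow (by norm_num) hn0.le, mul_assoc, ← Real.rpow_add hn0]
      congr 2
      ring

/-- For `0 < p₀ ≤ p ≤ 2` and `2n ≤ m`, the Weyl numbers of
`id : ℓ_{p₀}^m → ℓ_p^m` satisfy `x_n(id) ≍ n^{1/p - 1/p₀}`, with equivalence
constants independent of `n` and `m`. -/
theorem weyl_lp_id_small_exponents (p₀ p : ℝ)
    (hp₀ : 0 < p₀) (hp₀p : p₀ ≤ p) (hp2 : p ≤ 2) :
    ∃ c₁ c₂ : ℝ, 0 < c₁ ∧ 0 < c₂ ∧ ∀ m n : ℕ, 1 ≤ n → 2 * n ≤ m →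
      ENNReal.ofReal (c₁ * (n : ℝ) ^ (1 / p - 1 / p₀)) ≤
        genWeylNum (Fin m → ℂ) (lpNorm p₀) (lpNorm p) n ∧
      genWeylNum (Fin m → ℂ) (lpNorm p₀) (lpNorm p) n ≤
        ENNReal.ofReal (c₂ * (n : ℝ) ^ (1 / p - 1 / p₀)) := by
  refine ⟨(2 : ℝ) ^ (1 / 2 - 1 / p₀), 1, by positivity, one_pos, fun m n hn hnm => ⟨?_, ?_⟩⟩
  · obtain ⟨A, hA, hAF⟩ := exists_forall_rank_lt_le_lpNorm_sub hp₀ hp₀p hp2 hn hnm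
    refine le_iSup_of_le ⟨A, hA⟩ (le_iInf fun F => ?_)
    obtain ⟨u, hu, h⟩ := hAF F.1 F.2
    exact le_iSup_of_le ⟨u, hu⟩ h
  · refine iSup_le fun A => ?_
    obtain ⟨F, hF, h⟩ := exists_rank_lt_lpNorm_sub_le hp₀ hp₀p hp2 hn A.1 A.2
    rw [one_mul]
    exact iInf_le_of_le ⟨F, hF⟩ (iSup_le fun u => h u.1 u.2)
end

section
/- Let 0 < p ≤ 2 < p0 ≤ ∞ and let m, n ∈ ℕ with n ≤ m/2. Then the Weyl numbers of id : ℓ_{p0}^m → ℓ_p^m satisfy x_n(id) ≳ m^{1/p − 1/2}, with implicit constant independent of n and m. -/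
open scoped ENNReal

/-- The `ℓ_p` norm on `ℂ^m` for `p ∈ (0,∞]`, with the `sup`-norm for `p = ∞`. -/
noncomputable def lpNormE (p : ℝ≥0∞) {m : ℕ} (x : Fin m → ℂ) : ℝ≥0∞ :=
  if p = ∞ then ⨆ i, (‖x i‖₊ : ℝ≥0∞) else (∑ i, (‖x i‖₊ : ℝ≥0∞) ^ p.toReal) ^ (1 / p.toReal)

/-- A subspace of `ℂ^m` of dimension at least `k` contains a vector in the unit ball of `ℓ_∞^m`
with at least `k` coordinates of modulus one: any extreme point of the unit ball of the subspace
is such a vector. -/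
theorem Submodule.exists_norm_le_one_finrank_le_card {ι : Type*} [Fintype ι]
    (K : Submodule ℂ (ι → ℂ)) :
    ∃ x ∈ K, (∀ i, ‖x i‖ ≤ 1) ∧
      Module.finrank ℂ K ≤ (Finset.univ.filter fun i => ‖x i‖ = 1).card := by
  have hcompact : IsCompact ((K : Set (ι → ℂ)) ∩ Metric.closedBall 0 1) :=
    (isCompact_closedBall 0 1).inter_left K.closed_of_finiteDimensional
  obtain ⟨x, hx⟩ := hcompact.extremePoints_nonempty
    ⟨0, K.zero_mem, Metric.mem_closedBall_self zero_le_one⟩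
  rw [mem_extremePoints_iff_left] at hx
  obtain ⟨⟨hxK, hxball⟩, hext⟩ := hx
  have hx1 : ∀ i, ‖x i‖ ≤ 1 := fun i => (norm_le_pi_norm x i).trans (by simpa using hxball)
  refine ⟨x, hxK, hx1, ?_⟩
  by_contra! hlt
  set I := Finset.univ.filter fun i => ‖x i‖ = 1 with hI
  let restr : K →ₗ[ℂ] (I → ℂ) := (LinearMap.funLeft ℂ ℂ ((↑) : I → ι)).comp K.subtype
  have hker : LinearMap.ker restr ≠ ⊥ :=
    LinearMap.ker_ne_bot_of_finrank_lt (by simpa using hlt)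
  obtain ⟨v, hv, hv0⟩ := Submodule.exists_mem_ne_zero_of_ne_bot hker
  have hvI : ∀ i, ‖x i‖ = 1 → (v : ι → ℂ) i = 0 := fun i hi =>
    congrFun (LinearMap.mem_ker.1 hv) ⟨i, by simp [hI, hi]⟩
  have hsmall : ∀ i, ∀ᶠ t : ℝ in nhdsWithin 0 (Set.Ioi 0),
      ‖x i‖ + t * ‖(v : ι → ℂ) i‖ ≤ 1 := by
    intro i
    rcases (hx1 i).eq_or_lt with hi | hi
    · exact Filter.Eventually.of_forall fun t => by simp [hvI i hi, hi]
    · have hcont : Filter.Tendsto (fun t : ℝ => ‖x i‖ + t * ‖(v : ι → ℂ) i‖)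
          (nhdsWithin 0 (Set.Ioi 0)) (nhds ‖x i‖) := by
        have : Continuous fun t : ℝ => ‖x i‖ + t * ‖(v : ι → ℂ) i‖ := by fun_prop
        simpa using (this.tendsto 0).mono_left nhdsWithin_le_nhds
      exact (hcont.eventually_lt_const hi).mono fun t ht => ht.le
  obtain ⟨t, ht, ht0⟩ :=
    ((Filter.eventually_all.2 hsmall).and self_mem_nhdsWithin).exists
  have ht0 : 0 < t := ht0
  have hmem : ∀ s : ℝ, |s| = t →
      x + (s : ℂ) • (v : ι → ℂ) ∈ (K : Set (ι → ℂ)) ∩ Metric.closedBall 0 1 := by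
    intro s hs
    refine ⟨K.add_mem hxK (K.smul_mem _ v.2), ?_⟩
    rw [mem_closedBall_zero_iff, pi_norm_le_iff_of_nonneg zero_le_one]
    intro i
    calc ‖(x + (s : ℂ) • (v : ι → ℂ)) i‖ ≤ ‖x i‖ + ‖(s : ℂ) * (v : ι → ℂ) i‖ := norm_add_le _ _
      _ = ‖x i‖ + t * ‖(v : ι → ℂ) i‖ := by simp [hs]
      _ ≤ 1 := ht i
  have hmid : x ∈ openSegment ℝ (x + (t : ℂ) • (v : ι → ℂ)) (x + ((-t : ℝ) : ℂ) • (v : ι → ℂ)) := by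
    refine ⟨1 / 2, 1 / 2, by norm_num, by norm_num, by norm_num, ?_⟩
    ext i
    simp
    ring
  have heq := hext _ (hmem t (abs_of_pos ht0)) _ (hmem (-t) (by simp [abs_of_pos ht0])) hmid
  have : (v : ι → ℂ) = 0 := by
    have h := add_eq_left.1 heq
    exact (smul_eq_zero.1 h).resolve_left (by exact_mod_cast ht0.ne')
  exact hv0 (Subtype.ext this)

/-- The projection of `ℓ₂` onto its first `m` coordinates. -/
noncomputable def ellTwoProj (m : ℕ) : ellTwo →ₗ[ℂ] (Fin m → ℂ) where
  toFun u i := u i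
  map_add' _ _ := rfl
  map_smul' _ _ := rfl

/-- The embedding of `ℂ^m` into `ℓ₂` as the first `m` coordinates. -/
noncomputable def ellTwoIncl (m : ℕ) : (Fin m → ℂ) →ₗ[ℂ] ellTwo where
  toFun x := ∑ i : Fin m, lp.single (E := fun _ : ℕ => ℂ) 2 (i : ℕ) (x i)
  map_add' x y := by simp [lp.single_add, Finset.sum_add_distrib]
  map_smul' c x := by simp only [Pi.smul_apply, lp.single_smul, Finset.smul_sum, RingHom.id_apply]

theorem ellTwoProj_ellTwoIncl {m : ℕ} (x : Fin m → ℂ) :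
    ellTwoProj m (ellTwoIncl m x) = x := by
  ext j
  change (∑ i : Fin m, lp.single (E := fun _ : ℕ => ℂ) 2 (i : ℕ) (x i) : ellTwo).1 (j : ℕ) = x j
  rw [lp.coeFn_sum]
  refine (Finset.sum_apply _ _ _).trans ?_
  simp only [lp.single_apply, Pi.single_apply, Fin.val_inj]
  simp

theorem norm_ellTwoIncl_sq {m : ℕ} (x : Fin m → ℂ) :
    ‖ellTwoIncl m x‖ ^ 2 = ∑ i, ‖x i‖ ^ 2 := by
  have h := lp.norm_sum_single (E := fun _ : ℕ => ℂ) (p := 2) (by norm_num)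
    (fun i => if h : i < m then x ⟨i, h⟩ else 0) (Finset.range m)
  simp only [ENNReal.toReal_ofNat, Real.rpow_ofNat, Finset.sum_range] at h
  simpa [ellTwoIncl] using h

theorem sum_nnnorm_sq_ellTwoProj_le {m : ℕ} (u : ellTwo) :
    ∑ i, (‖ellTwoProj m u i‖₊ : ℝ≥0∞) ^ (2 : ℝ) ≤ ENNReal.ofReal ‖u‖ ^ (2 : ℝ) := by
  have h := lp.sum_rpow_le_norm_rpow (p := 2) (by norm_num) u (Finset.range m)
  simp only [ENNReal.toReal_ofNat, Finset.sum_range] at h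
  rw [ENNReal.ofReal_rpow_of_nonneg (norm_nonneg _) zero_le_two]
  refine le_trans (le_of_eq ?_) (ENNReal.ofReal_le_ofReal h)
  rw [ENNReal.ofReal_sum_of_nonneg fun _ _ => by positivity]
  refine Finset.sum_congr rfl fun i _ => ?_
  rw [← ENNReal.ofReal_rpow_of_nonneg (norm_nonneg _) zero_le_two, ofReal_norm]
  rfl

theorem lpNormE_ellTwoProj_le {q : ℝ≥0∞} (hq : 2 < q) {m : ℕ} (u : ellTwo) :
    lpNormE q (ellTwoProj m u) ≤ ENNReal.ofReal ‖u‖ := by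
  have hcoord : ∀ i, (‖ellTwoProj m u i‖₊ : ℝ≥0∞) ≤ ENNReal.ofReal ‖u‖ := by
    intro i
    rw [← enorm_eq_nnnorm, ← ofReal_norm]
    exact ENNReal.ofReal_le_ofReal (lp.norm_apply_le_norm two_ne_zero u i)
  rw [lpNormE]
  split_ifs with htop
  · exact iSup_le hcoord
  · set r := q.toReal
    have hr : 2 < r := by
      simpa using (ENNReal.toReal_lt_toReal ENNReal.ofNat_ne_top htop).2 hq
    have hr2 : 0 ≤ r - 2 := by linarith
    rw [one_div, ENNReal.rpow_inv_le_iff (by linarith)]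
    have hsplit : ∀ a : ℝ≥0∞, a ^ r = a ^ (2 : ℝ) * a ^ (r - 2) := fun a => by
      rw [← ENNReal.rpow_add_of_nonneg _ _ zero_le_two hr2, add_sub_cancel]
    calc ∑ i, (‖ellTwoProj m u i‖₊ : ℝ≥0∞) ^ r
        ≤ ∑ i, (‖ellTwoProj m u i‖₊ : ℝ≥0∞) ^ (2 : ℝ) * ENNReal.ofReal ‖u‖ ^ (r - 2) := by
          refine Finset.sum_le_sum fun i _ => ?_
          rw [hsplit]
          gcongr
          exact hcoord i
      _ ≤ ENNReal.ofReal ‖u‖ ^ (2 : ℝ) * ENNReal.ofReal ‖u‖ ^ (r - 2) := by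
          rw [← Finset.sum_mul]
          gcongr
          exact sum_nnnorm_sq_ellTwoProj_le u
      _ = ENNReal.ofReal ‖u‖ ^ r := (hsplit _).symm

theorem lpNorm_smul {p : ℝ} (hp : 0 < p) {m : ℕ} (c : ℂ) (x : Fin m → ℂ) :
    lpNorm p (c • x) = ‖c‖₊ * lpNorm p x := by
  simp only [lpNorm, Pi.smul_apply, nnnorm_smul, ENNReal.coe_mul,
    ENNReal.mul_rpow_of_nonneg _ _ hp.le, ← Finset.mul_sum]
  rw [ENNReal.mul_rpow_of_nonneg _ _ (by positivity), ← ENNReal.rpow_mul, mul_one_div_cancel hp.ne',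
    ENNReal.rpow_one]

theorem card_rpow_le_lpNorm {p : ℝ} (hp : 0 < p) {m : ℕ} (x : Fin m → ℂ) :
    ((Finset.univ.filter fun i => ‖x i‖ = 1).card : ℝ≥0∞) ^ (1 / p) ≤ lpNorm p x := by
  refine ENNReal.rpow_le_rpow ?_ (by positivity)
  calc ((Finset.univ.filter fun i => ‖x i‖ = 1).card : ℝ≥0∞)
      = ∑ i with ‖x i‖ = 1, (‖x i‖₊ : ℝ≥0∞) ^ p := by
        rw [Finset.cast_card]
        refine Finset.sum_congr rfl fun i hi => ?_
        have : ‖x i‖₊ = 1 := NNReal.eq (Finset.mem_filter.1 hi).2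
        simp [this]
    _ ≤ ∑ i, (‖x i‖₊ : ℝ≥0∞) ^ p := Finset.sum_le_sum_of_subset (Finset.filter_subset _ _)

theorem le_finrank_ker_comp_ellTwoIncl {m n : ℕ} (F : ellTwo →ₗ[ℂ] (Fin m → ℂ))
    (hF : Module.rank ℂ (LinearMap.range F) < (n : Cardinal)) :
    m - n ≤ Module.finrank ℂ (LinearMap.ker (F ∘ₗ ellTwoIncl m)) := by
  have hle : Module.finrank ℂ (LinearMap.range (F ∘ₗ ellTwoIncl m)) ≤
      Module.finrank ℂ (LinearMap.range F) :=
    Submodule.finrank_mono (LinearMap.range_comp_le_range _ _)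
  have hlt : Module.finrank ℂ (LinearMap.range F) < n := by
    rwa [← Module.finrank_eq_rank, Nat.cast_lt] at hF
  have hdim := LinearMap.finrank_range_add_finrank_ker (F ∘ₗ ellTwoIncl m)
  rw [Module.finrank_fin_fun] at hdim
  omega

/-- For `0 < p ≤ 2 < p₀ ≤ ∞` and `n ≤ m/2`, the Weyl numbers of
`id : ℓ_{p₀}^m → ℓ_p^m` satisfy `x_n(id) ≳ m^{1/p - 1/2}`, with implicit constant
independent of `n` and `m`. -/
theorem weyl_lp_id_lower (p : ℝ) (p₀ : ℝ≥0∞)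
    (hp : 0 < p) (hp2 : p ≤ 2) (hp₀ : (2 : ℝ≥0∞) < p₀) :
    ∃ c : ℝ, 0 < c ∧ ∀ m n : ℕ, 1 ≤ n → 2 * n ≤ m →
      ENNReal.ofReal (c * (m : ℝ) ^ (1 / p - 1 / 2)) ≤
        genWeylNum (Fin m → ℂ) (lpNormE p₀) (lpNorm p) n := by
  refine ⟨(1 / 2) ^ (1 / p), by positivity, fun m n hn hnm => ?_⟩
  have hm : (0 : ℝ) < m := by exact_mod_cast (by omega : 0 < m)
  refine le_iSup_of_le ⟨ellTwoProj m, lpNormE_ellTwoProj_le hp₀⟩ (le_iInf fun ⟨F, hF⟩ => ?_)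
  obtain ⟨x, hxker, hx1, hcard⟩ :=
    (LinearMap.ker (F ∘ₗ ellTwoIncl m)).exists_norm_le_one_finrank_le_card
  have hFx : F (ellTwoIncl m x) = 0 := hxker
  have hnorm : ‖ellTwoIncl m x‖ ≤ √m := by
    refine Real.le_sqrt_of_sq_le ?_
    rw [norm_ellTwoIncl_sq]
    calc ∑ i, ‖x i‖ ^ 2 ≤ ∑ _i : Fin m, (1 : ℝ) :=
          Finset.sum_le_sum fun i _ => pow_le_one₀ (norm_nonneg _) (hx1 i)
      _ = m := by simp
  have hsqrt : ‖(((√m)⁻¹ : ℝ) : ℂ)‖ = (√m)⁻¹ := by simp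
  have hu : ‖(((√m)⁻¹ : ℝ) : ℂ) • ellTwoIncl m x‖ ≤ 1 := by
    rw [norm_smul, hsqrt, inv_mul_le_iff₀ (by positivity), mul_one]
    exact hnorm
  have hhalf : (m : ℝ) / 2 ≤ ((Finset.univ.filter fun i => ‖x i‖ = 1).card : ℝ) := by
    have := (le_finrank_ker_comp_ellTwoIncl F hF).trans hcard
    have : m ≤ 2 * (Finset.univ.filter fun i => ‖x i‖ = 1).card := by omega
    have : (m : ℝ) ≤ 2 * ((Finset.univ.filter fun i => ‖x i‖ = 1).card : ℝ) := by exact_mod_cast this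
    linarith
  refine le_iSup_of_le ⟨_, hu⟩ ?_
  simp only [map_smul, hFx, ellTwoProj_ellTwoIncl, smul_zero, sub_zero]
  rw [lpNorm_smul hp, ← enorm_eq_nnnorm, ← ofReal_norm, hsqrt]
  calc ENNReal.ofReal ((1 / 2) ^ (1 / p) * (m : ℝ) ^ (1 / p - 1 / 2))
      = ENNReal.ofReal (√m)⁻¹ * ENNReal.ofReal (m / 2) ^ (1 / p) := by
        rw [ENNReal.ofReal_rpow_of_nonneg (by positivity) (by positivity),
          ← ENNReal.ofReal_mul (by positivity), Real.rpow_sub hm, ← Real.sqrt_eq_rpow,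
          div_eq_mul_one_div (m : ℝ) 2, Real.mul_rpow hm.le (by norm_num)]
        ring_nf
    _ ≤ ENNReal.ofReal (√m)⁻¹ *
          ((Finset.univ.filter fun i => ‖x i‖ = 1).card : ℝ≥0∞) ^ (1 / p) := by
        gcongr
        exact ENNReal.ofReal_le_of_le_toReal (by simpa using hhalf)
    _ ≤ ENNReal.ofReal (√m)⁻¹ * lpNorm p x := by
        gcongr
        exact card_rpow_le_lpNorm hp x
end
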